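/- Let 1 ≤ p < ∞, let B be the closed unit ball of the real sequence space ℓ^p, and for ε > 0 let N_ε be the least number of closed d_p-balls of radius ε with centers in B needed to cover B. Then the limit lim_{ε→0⁺} ln(ln N_ε) / ln(ln(1/ε)) exists and equals 2; that is, the functional box dimension of the unit ball of ℓ^p (covered in the weak metric d_p) is 2. -/

import Mathlib

open Filter Topology Set
open scoped ENNReal ENat Classical

noncomputable section

/-- The closed unit ball of the real sequence space `ℓ^p`, realized inside the space of
all real sequences: those `x` with `Σ_k |x k|^p ≤ 1` (the sum computed in `[0,∞]`, so
membership forces `p`-summability). -/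
def ellpBall (p : ℝ) : Set (ℕ → ℝ) :=
  {x : ℕ → ℝ | ∑' k : ℕ, ENNReal.ofReal (|x k| ^ p) ≤ 1}

/-- The metric `d_p(x,y) = (Σ_{k≥1} 4^{-k} |x(k) - y(k)|^p)^{1/p}` (sequences indexed by
`ℕ`, the `k`-th entry playing the role of `x(k+1)`). It induces the weak topology on
bounded subsets of `ℓ^p`. -/
def dLp (p : ℝ) (x y : ℕ → ℝ) : ℝ :=
  (∑' k : ℕ, (4 : ℝ)⁻¹ ^ (k + 1) * |x k - y k| ^ p) ^ (1 / p)

/-- The least number of closed `d_p`-balls of radius `ε` with centers in the unit ball of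
`ℓ^p` needed to cover the unit ball; `∞` if there is no finite such cover. -/
def covB (p : ℝ) (ε : ℝ) : ℕ∞ :=
  sInf {n : ℕ∞ | ∃ s : Finset (ℕ → ℝ), (↑s : Set (ℕ → ℝ)) ⊆ ellpBall p ∧
    (ellpBall p ⊆ ⋃ c ∈ s, {y : ℕ → ℝ | dLp p c y ≤ ε}) ∧ (s.card : ℕ∞) = n}

/-- Apply a scale function to an extended natural number, with `φ(∞) = ∞`,
landing in `[0,∞]`. -/
def phiApp (φ : ℝ → ℝ) (n : ℕ∞) : ℝ≥0∞ :=
  if n = ⊤ then ⊤ else ENNReal.ofReal (φ n.toNat)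


/-- Entries of a sequence in the unit ball have absolute value at most `1`. -/
lemma abs_le_one_of_mem_ellpBall {p : ℝ} (hp : 0 < p) {x : ℕ → ℝ} (hx : x ∈ ellpBall p)
    (k : ℕ) : |x k| ≤ 1 := by
  have h : ENNReal.ofReal (|x k| ^ p) ≤ 1 := (ENNReal.le_tsum k).trans hx
  rw [ENNReal.ofReal_le_one] at h
  by_contra! hlt
  exact absurd h (not_le.mpr (Real.one_lt_rpow hlt hp))

lemma zero_mem_ellpBall {p : ℝ} (hp : 0 < p) : (0 : ℕ → ℝ) ∈ ellpBall p := by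
  simp [ellpBall, Real.zero_rpow hp.ne']

lemma abs_sub_le_two_of_mem_ellpBall {p : ℝ} (hp : 0 < p) {x y : ℕ → ℝ}
    (hx : x ∈ ellpBall p) (hy : y ∈ ellpBall p) (k : ℕ) : |x k - y k| ≤ 2 := by
  have := abs_sub (x k) (y k)
  have := abs_le_one_of_mem_ellpBall hp hx k
  have := abs_le_one_of_mem_ellpBall hp hy k
  linarith

lemma summable_dLp {p : ℝ} (hp : 0 < p) {x y : ℕ → ℝ}
    (hx : x ∈ ellpBall p) (hy : y ∈ ellpBall p) :
    Summable fun k : ℕ => (4 : ℝ)⁻¹ ^ (k + 1) * |x k - y k| ^ p := by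
  have hs : Summable fun k : ℕ => (4 : ℝ)⁻¹ ^ (k + 1) * 2 ^ p :=
    ((summable_nat_add_iff 1).mpr
      (summable_geometric_of_lt_one (by norm_num) (by norm_num))).mul_right _
  refine hs.of_nonneg_of_le (fun k => by positivity) fun k => ?_
  have := abs_sub_le_two_of_mem_ellpBall hp hx hy k
  gcongr

/-- Weighted coordinates are controlled by the metric `dLp`. -/
lemma abs_sub_le_four_pow_mul {p : ℝ} (hp : 1 ≤ p) {x y : ℕ → ℝ}
    (hx : x ∈ ellpBall p) (hy : y ∈ ellpBall p) {ε : ℝ} (hε : 0 ≤ ε) (h : dLp p x y ≤ ε) (k : ℕ) :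
    |x k - y k| ≤ 4 ^ (k + 1) * ε := by
  have hp0 : 0 < p := by linarith
  have hk := (summable_dLp hp0 hx hy).le_tsum k fun j _ => by positivity
  have hS : ∑' k : ℕ, (4 : ℝ)⁻¹ ^ (k + 1) * |x k - y k| ^ p ≤ ε ^ p := by
    rw [dLp, one_div] at h
    exact (Real.rpow_inv_le_iff_of_pos (tsum_nonneg fun j => by positivity) hε hp0).mp h
  have h4 : |x k - y k| ^ p ≤ 4 ^ (k + 1) * ε ^ p := by
    have := hk.trans hS
    rwa [inv_pow, inv_mul_le_iff₀ (by positivity)] at this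
  have h5 : (4 : ℝ) ^ (k + 1) * ε ^ p ≤ (4 ^ (k + 1) * ε) ^ p := by
    rw [Real.mul_rpow (by positivity) hε]
    gcongr
    exact Real.self_le_rpow_of_one_le (one_le_pow₀ (by norm_num)) hp
  exact (Real.rpow_le_rpow_iff (abs_nonneg _) (by positivity) hp0).mp (h4.trans h5)

lemma dLp_le_of_forall_lt {p : ℝ} (hp : 0 < p) {x y : ℕ → ℝ}
    (hx : x ∈ ellpBall p) (hy : y ∈ ellpBall p) {ε : ℝ} (hε : 0 ≤ ε) {n : ℕ}
    (hn : 2 ^ p * (2 : ℝ)⁻¹ ^ n ≤ ε ^ p) (h : ∀ k < n, |x k - y k| ≤ ε) :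
    dLp p x y ≤ ε := by
  have hhalf : HasSum (fun k : ℕ => (2 : ℝ)⁻¹ ^ (k + 1) * ε ^ p) (ε ^ p) := by
    convert hasSum_geometric_two' (ε ^ p) using 2 with k
    rw [pow_succ, inv_pow]
    ring
  have hterm : ∀ k : ℕ, (4 : ℝ)⁻¹ ^ (k + 1) * |x k - y k| ^ p ≤ (2 : ℝ)⁻¹ ^ (k + 1) * ε ^ p := by
    intro k
    rcases lt_or_ge k n with hk | hk
    · have := h k hk
      gcongr
      norm_num
    · have h2 := abs_sub_le_two_of_mem_ellpBall hp hx hy k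
      calc (4 : ℝ)⁻¹ ^ (k + 1) * |x k - y k| ^ p ≤ (4 : ℝ)⁻¹ ^ (k + 1) * 2 ^ p := by gcongr
        _ = (2 : ℝ)⁻¹ ^ (k + 1) * (2 ^ p * (2 : ℝ)⁻¹ ^ (k + 1)) := by
          rw [show (4 : ℝ)⁻¹ = 2⁻¹ * 2⁻¹ by norm_num, mul_pow]; ring
        _ ≤ (2 : ℝ)⁻¹ ^ (k + 1) * (2 ^ p * (2 : ℝ)⁻¹ ^ n) := by
          gcongr (2 : ℝ)⁻¹ ^ (k + 1) * (2 ^ p * ?_)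
          exact pow_le_pow_of_le_one (by norm_num) (by norm_num) (by omega)
        _ ≤ _ := by gcongr
  rw [dLp, one_div]
  refine (Real.rpow_inv_le_iff_of_pos (tsum_nonneg fun j => by positivity) hε hp).mpr ?_
  rw [← hhalf.tsum_eq]
  exact (summable_dLp hp hx hy).tsum_le_tsum hterm hhalf.summable

/-- Upper bound for the covering numbers, by a grid of mesh `ε` in the first `n` coordinates. -/
lemma covB_le {p : ℝ} (hp : 0 < p) {ε : ℝ} (hε : 0 < ε) {n M : ℕ}
    (hn : 2 ^ p * (2 : ℝ)⁻¹ ^ n ≤ ε ^ p) (hM : 1 / ε ≤ M) :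
    covB p ε ≤ (((2 * M + 1) ^ n : ℕ) : ℕ∞) := by
  let G : (ℕ → ℝ) → Fin n → ℤ := fun x k => ⌊x k / ε⌋
  let T : Finset (Fin n → ℤ) := Fintype.piFinset fun _ => Finset.Icc (-(M : ℤ)) M
  let r : (Fin n → ℤ) → ℕ → ℝ := fun t =>
    if h : ∃ x ∈ ellpBall p, G x = t then h.choose else 0
  have hr : ∀ t, r t ∈ ellpBall p := by
    intro t
    by_cases h : ∃ x ∈ ellpBall p, G x = t
    · simp only [r, dif_pos h]
      exact h.choose_spec.1
    · simp only [r, dif_neg h]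
      exact zero_mem_ellpBall hp
  have hcard : (T.image r).card ≤ (2 * M + 1) ^ n := by
    refine Finset.card_image_le.trans (le_of_eq ?_)
    simp only [T, Fintype.card_piFinset, Int.card_Icc, Finset.prod_const, Finset.card_univ,
      Fintype.card_fin]
    congr 1
    omega
  have hcard' : ((T.image r).card : ℕ∞) ≤ (((2 * M + 1) ^ n : ℕ) : ℕ∞) := by
    exact_mod_cast hcard
  refine le_trans (sInf_le ?_) hcard'
  refine ⟨T.image r, ?_, ?_, rfl⟩
  · intro x hx
    obtain ⟨t, -, rfl⟩ := Finset.mem_image.mp (Finset.mem_coe.mp hx)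
    exact hr t
  · intro y hy
    have hex : ∃ x ∈ ellpBall p, G x = G y := ⟨y, hy, rfl⟩
    have hG : G (r (G y)) = G y := by
      simp only [r, dif_pos hex]
      exact hex.choose_spec.2
    have hT : G y ∈ T := by
      refine Fintype.mem_piFinset.mpr fun k => Finset.mem_Icc.mpr ?_
      have h1 := abs_le.mp (abs_le_one_of_mem_ellpBall hp hy k)
      have h2 : y k / ε ≤ M := (div_le_div_of_nonneg_right h1.2 hε.le).trans hM
      have h3 : -(M : ℝ) ≤ y k / ε := by
        have := div_le_div_of_nonneg_right h1.1 hε.le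
        rw [neg_div] at this
        linarith
      refine ⟨Int.le_floor.mpr (by push_cast; exact h3), ?_⟩
      exact_mod_cast (Int.floor_le (y k / ε)).trans h2
    refine mem_iUnion₂.mpr ⟨r (G y), Finset.mem_image_of_mem r hT, ?_⟩
    refine dLp_le_of_forall_lt hp (hr _) hy hε.le hn fun k hk => ?_
    have := Int.abs_sub_lt_one_of_floor_eq_floor (congrFun hG ⟨k, hk⟩)
    simp only at this
    rw [← sub_div, abs_div, abs_of_pos hε, div_lt_one hε] at this
    exact this.le

/-- The point of the unit ball with coordinates `f k / (n * 2 ^ n)` for `k < n`. -/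
def gridPoint (n : ℕ) (f : Fin n → Fin (2 ^ n)) (k : ℕ) : ℝ :=
  if h : k < n then (f ⟨k, h⟩ : ℝ) / (n * 2 ^ n) else 0

lemma gridPoint_mem {p : ℝ} (hp : 1 ≤ p) (n : ℕ) (f : Fin n → Fin (2 ^ n)) :
    gridPoint n f ∈ ellpBall p := by
  have hp0 : p ≠ 0 := by linarith
  have hz : ∀ k ∉ Finset.range n, ENNReal.ofReal (|gridPoint n f k| ^ p) = 0 := by
    intro k hk
    have : ¬ k < n := by simpa using hk
    simp [gridPoint, this, Real.zero_rpow hp0]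
  change ∑' k : ℕ, ENNReal.ofReal (|gridPoint n f k| ^ p) ≤ 1
  rw [tsum_eq_sum hz, ← ENNReal.ofReal_sum_of_nonneg fun k _ => by positivity,
    ENNReal.ofReal_le_one]
  have hle : ∀ k ∈ Finset.range n, |gridPoint n f k| ^ p ≤ 1 / n := by
    intro k hk
    have hk : k < n := by simpa using hk
    have hn : (1 : ℝ) ≤ n := by exact_mod_cast (by omega : 1 ≤ n)
    have hf : (f ⟨k, hk⟩ : ℝ) ≤ 2 ^ n := by exact_mod_cast (f ⟨k, hk⟩).2.le
    have h1 : |gridPoint n f k| ≤ 1 / n := by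
      rw [gridPoint, dif_pos hk, abs_of_nonneg (by positivity),
        div_le_div_iff₀ (by positivity) (by positivity)]
      nlinarith
    refine le_trans ?_ h1
    exact Real.rpow_le_self_of_le_one (abs_nonneg _)
      (h1.trans ((div_le_one (by linarith)).mpr hn)) hp
  refine (Finset.sum_le_sum hle).trans ?_
  simp only [Finset.sum_const, Finset.card_range, nsmul_eq_mul, one_div]
  exact mul_inv_le_one

/-- Lower bound for the covering numbers, by a separated family of grid points. -/
lemma le_covB {p : ℝ} (hp : 1 ≤ p) {ε : ℝ} (hε : 0 ≤ ε) {n : ℕ}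
    (hn : 2 * ε * 16 ^ n < 1) : ((2 ^ (n * n) : ℕ) : ℕ∞) ≤ covB p ε := by
  refine le_sInf ?_
  rintro _ ⟨s, hsB, hcov, rfl⟩
  have hc : ∀ f : Fin n → Fin (2 ^ n), ∃ c ∈ s, dLp p c (gridPoint n f) ≤ ε := by
    intro f
    simpa using hcov (gridPoint_mem hp n f)
  choose c hcs hcd using hc
  have hinj : Function.Injective c := by
    intro f g hfg
    by_contra hne
    obtain ⟨k, hk⟩ := Function.ne_iff.mp hne
    have hf := abs_sub_le_four_pow_mul hp (hsB (hcs f)) (gridPoint_mem hp n f) hε (hcd f) k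
    have hg := abs_sub_le_four_pow_mul hp (hsB (hcs g)) (gridPoint_mem hp n g) hε (hcd g) k
    rw [← hfg] at hg
    have hn0 : 0 < n := k.pos
    have hn1 : (0 : ℝ) < n := by exact_mod_cast hn0
    have htri : |gridPoint n f k - gridPoint n g k| ≤ 2 * (4 ^ n * ε) := by
      have h4 : (4 : ℝ) ^ ((k : ℕ) + 1) * ε ≤ 4 ^ n * ε := by
        gcongr
        · norm_num
        · exact k.2
      have := abs_sub_le (gridPoint n f k) (c f k) (gridPoint n g k)
      rw [abs_sub_comm (gridPoint n f k) (c f k)] at this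
      linarith
    have hsep : 1 / (n * 2 ^ n : ℝ) ≤ |gridPoint n f k - gridPoint n g k| := by
      simp only [gridPoint, dif_pos k.2, Fin.eta]
      rw [← sub_div, abs_div, abs_of_pos (show (0 : ℝ) < n * 2 ^ n by positivity)]
      gcongr
      have : (1 : ℤ) ≤ |((f k : ℕ) : ℤ) - ((g k : ℕ) : ℤ)| := by
        refine Int.one_le_abs (sub_ne_zero.mpr fun h => hk (Fin.ext ?_))
        exact_mod_cast h
      exact_mod_cast this
    have h1 := hsep.trans htri
    rw [div_le_iff₀ (by positivity)] at h1
    have h2 : (n : ℝ) ≤ 2 ^ n := by exact_mod_cast Nat.lt_two_pow_self.le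
    have h3 : 2 * (4 ^ n * ε) * (n * 2 ^ n) ≤ 2 * (4 ^ n * ε) * ((2 : ℝ) ^ n * 2 ^ n) := by
      gcongr
    have h4 : 2 * (4 ^ n * ε) * ((2 : ℝ) ^ n * 2 ^ n) = 2 * ε * 16 ^ n := by
      rw [show (16 : ℝ) = 4 * (2 * 2) by norm_num, mul_pow, mul_pow]; ring
    linarith
  have := Finset.card_le_card_of_injOn c (s := Finset.univ) (t := s) (fun f _ => hcs f)
    hinj.injOn
  rw [Finset.card_univ, Fintype.card_fun, Fintype.card_fin, Fintype.card_fin, ← pow_mul] at this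
  exact_mod_cast this

lemma log_covB_le {p : ℝ} (hp : 1 ≤ p) {ε : ℝ} (hε : 0 < ε) (hL : 1 ≤ Real.log (1 / ε)) :
    covB p ε ≠ ⊤ ∧
      Real.log (covB p ε).toNat ≤ 15 * p * Real.log (1 / ε) ^ 2 := by
  have hp0 : 0 < p := by linarith
  set L := Real.log (1 / ε) with hLdef
  have hexp : Real.exp L = 1 / ε := Real.exp_log (by positivity)
  have he : ε = Real.exp (-L) := by rw [Real.exp_neg, hexp]; simp
  set n := ⌈2 * p * (L + 1)⌉₊ with hn
  set M := ⌈1 / ε⌉₊ with hM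
  have hlog2 := Real.log_two_gt_d9
  have hn1 : 2 * p * (L + 1) ≤ n := Nat.le_ceil _
  have hn2 : (n : ℝ) < 2 * p * (L + 1) + 1 := Nat.ceil_lt_add_one (by positivity)
  have hM2 : (M : ℝ) < 1 / ε + 1 := Nat.ceil_lt_add_one (by positivity)
  have hcond : 2 ^ p * (2 : ℝ)⁻¹ ^ n ≤ ε ^ p := by
    rw [← Real.rpow_natCast, Real.inv_rpow (by norm_num), ← Real.rpow_neg (by norm_num),
      ← Real.rpow_add (by norm_num), he, ← Real.exp_mul, Real.rpow_def_of_pos (by norm_num)]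
    refine Real.exp_le_exp.mpr ?_
    have hl1 := Real.log_two_lt_d9
    have : 2 * p * (L + 1) * Real.log 2 ≤ n * Real.log 2 := by gcongr
    have h3 : 0 ≤ p * L * (2 * Real.log 2 - 1) := by
      apply mul_nonneg (by positivity); linarith
    have h4 : 0 ≤ p * Real.log 2 := by positivity
    nlinarith
  have hle := covB_le hp0 hε hcond (Nat.le_ceil _)
  rw [← hM] at hle
  have htop : covB p ε ≠ ⊤ := ne_top_of_le_ne_top (ENat.natCast_ne_top _) hle
  refine ⟨htop, ?_⟩
  have hnat : (covB p ε).toNat ≤ (2 * M + 1) ^ n := by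
    have := ENat.toNat_le_toNat hle (ENat.natCast_ne_top _)
    rwa [ENat.toNat_natCast] at this
  have hM3 : Real.log (2 * M + 1) ≤ L + 2 := by
    rw [Real.log_le_iff_le_exp (by positivity), Real.exp_add, hexp]
    have he2 : (5 : ℝ) ≤ Real.exp 2 := by
      have := Real.exp_one_gt_d9
      rw [show (2 : ℝ) = 1 + 1 by norm_num, Real.exp_add]
      nlinarith
    have h1 : 1 ≤ 1 / ε := by
      rw [← hexp]; exact Real.one_le_exp (by linarith)
    nlinarith
  have hM0 : 0 ≤ Real.log (2 * M + 1) := Real.log_nonneg (by linarith [Nat.cast_nonneg (α := ℝ) M])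
  have hlog : Real.log (covB p ε).toNat ≤ n * Real.log (2 * M + 1) := by
    rw [← Real.log_pow]
    rcases Nat.eq_zero_or_pos (covB p ε).toNat with h0 | h0
    · rw [h0, Nat.cast_zero, Real.log_zero, Real.log_pow]
      positivity
    · refine Real.log_le_log (by exact_mod_cast h0) ?_
      exact_mod_cast hnat
  calc Real.log (covB p ε).toNat ≤ n * Real.log (2 * M + 1) := hlog
    _ ≤ (5 * p * L) * (3 * L) := by
      gcongr
      · nlinarith [mul_le_mul hp hL (by norm_num) (by linarith)]
      · linarith
    _ = _ := by ring

lemma le_log_covB {p : ℝ} (hp : 1 ≤ p) {ε : ℝ} (hε : 0 < ε) (hL : 16 ≤ Real.log (1 / ε))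
    (htop : covB p ε ≠ ⊤) : Real.log (1 / ε) ^ 2 / 512 ≤ Real.log (covB p ε).toNat := by
  set L := Real.log (1 / ε) with hLdef
  have hexp : Real.exp L = 1 / ε := Real.exp_log (by positivity)
  have he : ε = Real.exp (-L) := by rw [Real.exp_neg, hexp]; simp
  set n := ⌊L / 8⌋₊ with hn
  have hn1 : (n : ℝ) ≤ L / 8 := Nat.floor_le (by positivity)
  have hn2 : L / 8 < n + 1 := Nat.lt_floor_add_one _
  have hcond : 2 * ε * 16 ^ n < 1 := by
    have h1 : (2 : ℝ) ≤ Real.exp 1 := by linarith [Real.exp_one_gt_d9]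
    have h16 : (16 : ℝ) ≤ Real.exp 4 := by
      rw [← Real.exp_one_rpow, show (4 : ℝ) = (4 : ℕ) by norm_num, Real.rpow_natCast]
      calc (16 : ℝ) = 2 ^ 4 := by norm_num
        _ ≤ _ := by gcongr
    calc 2 * ε * 16 ^ n ≤ Real.exp 1 * Real.exp (-L) * Real.exp 4 ^ n := by
          rw [← he]; gcongr
      _ = Real.exp (1 + -L + n * 4) := by
          rw [Real.exp_add, Real.exp_add, Real.exp_nat_mul]
      _ < 1 := Real.exp_lt_one_iff.mpr (by linarith)
  have hle := le_covB hp hε.le hcond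
  have hnat : 2 ^ (n * n) ≤ (covB p ε).toNat := by
    have := ENat.toNat_le_toNat hle htop
    rwa [ENat.toNat_natCast] at this
  have hlog : (n * n : ℕ) * Real.log 2 ≤ Real.log (covB p ε).toNat := by
    rw [← Real.log_pow]
    refine Real.log_le_log (by positivity) ?_
    exact_mod_cast hnat
  have hlog2 := Real.log_two_gt_d9
  push_cast at hlog
  have h3 : (L / 16) * (L / 16) * (1 / 2) ≤ n * n * Real.log 2 := by
    gcongr <;> linarith
  linarith

/-- for `1 ≤ p < ∞`, the functional box dimension of the unit ball of
`ℓ^p`, covered in the weak metric `d_p`, is `2`: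
`lim_{ε→0⁺} ln ln N_ε / ln ln (1/ε)` exists and equals `2`. -/
theorem ellpBall_functional_dimension (p : ℝ) (hp : 1 ≤ p) :
    Tendsto (fun ε : ℝ =>
        phiApp (fun t : ℝ => Real.log (Real.log t)) (covB p ε) /
          ENNReal.ofReal (Real.log (Real.log (1 / ε))))
      (𝓝[>] (0 : ℝ)) (𝓝 (2 : ℝ≥0∞)) := by
  have hL : Tendsto (fun ε : ℝ => Real.log (1 / ε)) (𝓝[>] 0) atTop := by
    simp only [one_div]
    exact Real.tendsto_log_atTop.comp tendsto_inv_nhdsGT_zero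
  have hLL := Real.tendsto_log_atTop.comp hL
  have hlim : ∀ C : ℝ, Tendsto (fun ε : ℝ => 2 + C / Real.log (Real.log (1 / ε)))
      (𝓝[>] 0) (𝓝 2) := by
    intro C
    simpa using (hLL.const_div_atTop C).const_add 2
  have key : Tendsto (fun ε : ℝ => Real.log (Real.log (covB p ε).toNat) /
      Real.log (Real.log (1 / ε))) (𝓝[>] 0) (𝓝 2) := by
    refine tendsto_of_tendsto_of_tendsto_of_le_of_le' (hlim (-Real.log 512))
      (hlim (Real.log (15 * p))) ?_ ?_
    · filter_upwards [hL.eventually_ge_atTop 16, hLL.eventually_gt_atTop 0,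
        self_mem_nhdsWithin] with ε h16 hpos hε
      simp only [Function.comp_apply] at hpos
      obtain ⟨htop, -⟩ := log_covB_le hp hε (by linarith)
      have h := Real.log_le_log (by positivity) (le_log_covB hp hε h16 htop)
      rw [Real.log_div (by positivity) (by norm_num), Real.log_pow] at h
      push_cast at h
      rw [le_div_iff₀ hpos, add_mul, div_mul_cancel₀ _ hpos.ne']
      linarith
    · filter_upwards [hL.eventually_ge_atTop 16, hLL.eventually_gt_atTop 0,
        self_mem_nhdsWithin] with ε h16 hpos hε
      simp only [Function.comp_apply] at hpos
      obtain ⟨htop, hup⟩ := log_covB_le hp hε (by linarith)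
      have hlow := le_log_covB hp hε h16 htop
      have h := Real.log_le_log (lt_of_lt_of_le (by positivity) hlow) hup
      rw [Real.log_mul (by positivity) (by positivity), Real.log_pow] at h
      push_cast at h
      rw [div_le_iff₀ hpos, add_mul, div_mul_cancel₀ _ hpos.ne']
      linarith
  have key' := ENNReal.tendsto_ofReal key
  rw [ENNReal.ofReal_ofNat] at key'
  refine key'.congr' ?_
  filter_upwards [hL.eventually_ge_atTop 1, hLL.eventually_gt_atTop 0,
    self_mem_nhdsWithin] with ε h1 hpos hε
  simp only [Function.comp_apply] at hpos
  rw [phiApp, if_neg (log_covB_le hp hε h1).1, ENNReal.ofReal_div_of_pos hpos]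

end
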